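/- arXiv:1901.00373 — 2 statements merged into one kernel-verified Lean document; each statement's English description precedes it below -/
import Mathlib

section
/- Mutual-consent symmetry: for every network state S and all agents i ≠ j, the two parties to a link have equal incremental payoffs from it, Δ_{g_{ij}} u_i(S) = Δ_{g_{ij}} u_j(S). Consequently, the stability constraint 'g_{ij} = 1 only if Δ_{g_{ij}} u_j ≥ 0' is satisfied at any state in which agent i has no profitable single-link deletion. -/
open Finset

namespace NEkSN

/-- A network state: a profile of binary actions together with a symmetric,
loopless adjacency matrix of friendship links. -/
abbrev NetState (n : ℕ) :=
  {S : (Fin n → Bool) × (Fin n → Fin n → Bool) //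
    (∀ i j, S.2 i j = S.2 j i) ∧ ∀ i, S.2 i i = false}

variable {n : ℕ}

noncomputable section

/-- The (real-valued) action of agent `i`. -/
def act (S : NetState n) (i : Fin n) : ℝ := if S.1.1 i then 1 else 0

/-- The (real-valued) link indicator between `i` and `j`. -/
def lnk (S : NetState n) (i j : Fin n) : ℝ := if S.1.2 i j then 1 else 0

/-- Agent `i`'s utility. -/
def util (v : Fin n → ℝ) (w : Fin n → Fin n → ℝ) (q : Fin n → Fin n → Fin n → ℝ)
    (h φ : ℝ) (i : Fin n) (S : NetState n) : ℝ :=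
  act S i * v i
    + ∑ j ∈ univ.erase i, lnk S i j * w i j
    + ∑ j ∈ univ.erase i, ∑ k ∈ univ.erase i,
        (if j < k then q i j k * lnk S i j * lnk S j k * lnk S k i else 0)
    + h * act S i * ∑ j ∈ univ.erase i, act S j
    + φ * ∑ j ∈ univ.erase i,
        lnk S i j * (act S i * act S j + (1 - act S i) * (1 - act S j))

/-- The potential function. -/
def potential (v : Fin n → ℝ) (w : Fin n → Fin n → ℝ) (q : Fin n → Fin n → Fin n → ℝ)
    (h φ : ℝ) (S : NetState n) : ℝ :=
  (∑ i, act S i * v i)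
    + (1 / 2) * ∑ i, ∑ j ∈ univ.erase i, lnk S i j * w i j
    + (h / 2) * ∑ i, ∑ j ∈ univ.erase i, act S i * act S j
    + (φ / 2) * ∑ i, ∑ j ∈ univ.erase i,
        lnk S i j * (act S i * act S j + (1 - act S i) * (1 - act S j))
    + ∑ i, ∑ j, ∑ k, (if i < j ∧ j < k then q i j k * lnk S i j * lnk S j k * lnk S k i else 0)

/-- The state `S` with `i`'s action set to `b`. -/
def setAct (S : NetState n) (i : Fin n) (b : Bool) : NetState n :=
  ⟨(Function.update S.1.1 i b, S.1.2), S.2⟩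

/-- The state `S` with the link between `i` and `j` (`i ≠ j`) set to `b`. -/
def setLink (S : NetState n) (i j : Fin n) (b : Bool) : NetState n :=
  ⟨(S.1.1, fun p q =>
      if p = q then false
      else if (p = i ∧ q = j) ∨ (p = j ∧ q = i) then b else S.1.2 p q), by
    refine ⟨fun p q => ?_, fun p => ?_⟩
    · by_cases hpq : p = q
      · simp [hpq]
      · have hqp : ¬q = p := fun hc => hpq hc.symm
        simp only [if_neg hpq, if_neg hqp]
        by_cases hc : (p = i ∧ q = j) ∨ (p = j ∧ q = i)
        · rw [if_pos hc, if_pos (by tauto)]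
        · rw [if_neg hc, if_neg (by tauto), S.2.1 p q]
    · simp⟩

/-- The state `S` with all links between `i` and members of `D` deleted. -/
def deleteLinks (S : NetState n) (i : Fin n) (D : Finset (Fin n)) : NetState n :=
  ⟨(S.1.1, fun p q => if (p = i ∧ q ∈ D) ∨ (q = i ∧ p ∈ D) then false else S.1.2 p q), by
    refine ⟨fun p q => ?_, fun p => ?_⟩
    · dsimp only
      by_cases hc : (p = i ∧ q ∈ D) ∨ (q = i ∧ p ∈ D)
      · rw [if_pos hc, if_pos (by tauto)]
      · rw [if_neg hc, if_neg (by tauto), S.2.1 p q]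
    · dsimp only
      split
      · rfl
      · exact S.2.2 p⟩

/-- Incremental utility of agent `i` from switching her action on. -/
def dActU (v : Fin n → ℝ) (w : Fin n → Fin n → ℝ) (q : Fin n → Fin n → Fin n → ℝ)
    (h φ : ℝ) (i : Fin n) (S : NetState n) : ℝ :=
  util v w q h φ i (setAct S i true) - util v w q h φ i (setAct S i false)

/-- Incremental potential from switching `i`'s action on. -/
def dActP (v : Fin n → ℝ) (w : Fin n → Fin n → ℝ) (q : Fin n → Fin n → Fin n → ℝ)
    (h φ : ℝ) (i : Fin n) (S : NetState n) : ℝ :=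
  potential v w q h φ (setAct S i true) - potential v w q h φ (setAct S i false)

/-- Incremental utility of agent `i` from the link with `j`. -/
def dLinkU (v : Fin n → ℝ) (w : Fin n → Fin n → ℝ) (q : Fin n → Fin n → Fin n → ℝ)
    (h φ : ℝ) (i j : Fin n) (S : NetState n) : ℝ :=
  util v w q h φ i (setLink S i j true) - util v w q h φ i (setLink S i j false)

/-- Incremental potential from the link between `i` and `j`. -/
def dLinkP (v : Fin n → ℝ) (w : Fin n → Fin n → ℝ) (q : Fin n → Fin n → Fin n → ℝ)
    (h φ : ℝ) (i j : Fin n) (S : NetState n) : ℝ :=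
  potential v w q h φ (setLink S i j true) - potential v w q h φ (setLink S i j false)

/-- A `k`-meeting: an agent `i` together with a set of `k - 1` other agents. -/
abbrev Meeting (n k : ℕ) :=
  {μ : Fin n × Finset (Fin n) // μ.1 ∉ μ.2 ∧ μ.2.card = k - 1}

/-- The `k`-neighborhood of `S` for meeting `μ = (i, I)`: all states agreeing with `S`
except possibly in `i`'s action and the links between `i` and members of `I`. -/
def nbhd {k : ℕ} (μ : Meeting n k) (S : NetState n) : Finset (NetState n) :=
  univ.filter fun S' =>
    (∀ p, p ≠ μ.1.1 → S'.1.1 p = S.1.1 p) ∧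
    (∀ p q, ¬((p = μ.1.1 ∧ q ∈ μ.1.2) ∨ (q = μ.1.1 ∧ p ∈ μ.1.2)) → S'.1.2 p q = S.1.2 p q)

/-- The feasible set for the decision problem of `μ.1` on the neighborhood of `S`:
states in the neighborhood satisfying the stability constraints. -/
def feasible (v : Fin n → ℝ) (w : Fin n → Fin n → ℝ) (q : Fin n → Fin n → Fin n → ℝ)
    (h φ : ℝ) {k : ℕ} (μ : Meeting n k) (S : NetState n) : Set (NetState n) :=
  {S' | S' ∈ nbhd μ S ∧
    ∀ j ∈ μ.1.2, S'.1.2 μ.1.1 j = true → 0 ≤ dLinkU v w q h φ j μ.1.1 S'}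

/-- Nash equilibrium in a `k`(-player) stable network. -/
def isNEkSN (v : Fin n → ℝ) (w : Fin n → Fin n → ℝ) (q : Fin n → Fin n → Fin n → ℝ)
    (h φ : ℝ) (k : ℕ) (S : NetState n) : Prop :=
  ∀ μ : Meeting n k,
    S ∈ feasible v w q h φ μ S ∧
    ∀ T ∈ feasible v w q h φ μ S, util v w q h φ μ.1.1 T ≤ util v w q h φ μ.1.1 S

/-- One-step transition kernel of the `k`-player consensual dynamic with logit shocks:
`kernel … ρ S' S = P_k(S' | S)`. -/
def kernel (v : Fin n → ℝ) (w : Fin n → Fin n → ℝ) (q : Fin n → Fin n → Fin n → ℝ)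
    (h φ : ℝ) (k : ℕ) (ρ : Meeting n k → ℝ) (S' S : NetState n) : ℝ :=
  ∑ μ : Meeting n k,
    if S' ∈ nbhd μ S then
      ρ μ * Real.exp (potential v w q h φ S') /
        ∑ T ∈ nbhd μ S, Real.exp (potential v w q h φ T)
    else 0

/-- The Gibbs (stationary) distribution `π(S) ∝ exp (Φ S)`. -/
def gibbs (v : Fin n → ℝ) (w : Fin n → Fin n → ℝ) (q : Fin n → Fin n → Fin n → ℝ)
    (h φ : ℝ) (S : NetState n) : ℝ :=
  Real.exp (potential v w q h φ S) / ∑ T : NetState n, Real.exp (potential v w q h φ T)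

/-- `m`-step transition probabilities of the `k`CD. -/
def kernelIter (v : Fin n → ℝ) (w : Fin n → Fin n → ℝ) (q : Fin n → Fin n → Fin n → ℝ)
    (h φ : ℝ) (k : ℕ) (ρ : Meeting n k → ℝ) : ℕ → NetState n → NetState n → ℝ
  | 0, S', S => if S' = S then 1 else 0
  | m + 1, S', S =>
      ∑ T : NetState n, kernel v w q h φ k ρ S' T * kernelIter v w q h φ k ρ m T S

/-- The eigenfunction `e_I` associated with a set `I` of coordinate pairs `(i, j)`, `i ≥ j`:
`(i, i)` refers to the action `a_i` and `(i, j)` with `i > j` to the link `g_{ij}`. -/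
def eig (I : Finset (Fin n × Fin n)) (S : NetState n) : ℝ :=
  ∏ p ∈ I,
    if p.1 = p.2 then (if S.1.1 p.1 then (-1 : ℝ) else 1)
    else (if S.1.2 p.1 p.2 then (-1 : ℝ) else 1)

/-- `I_i = {j ≠ i : (i, j) ∈ I or (j, i) ∈ I}`. -/
def linkedSet (I : Finset (Fin n × Fin n)) (i : Fin n) : Finset (Fin n) :=
  univ.filter fun j => j ≠ i ∧ ((i, j) ∈ I ∨ (j, i) ∈ I)

/-- The eigenvalue `λ_{k,I}`. -/
def lam (k : ℕ) (I : Finset (Fin n × Fin n)) : ℝ :=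
  (∑ i ∈ univ.filter (fun i : Fin n => (i, i) ∉ I),
      ((n - 1 - (linkedSet I i).card).choose (k - 1) : ℝ))
    / (n * ((n - 1).choose (k - 1) : ℝ))

/-- The one-flip neighborhood `N(S)`: states obtained from `S` by flipping exactly one
coordinate (one action or one link). -/
def flipNbhd (S : NetState n) : Set (NetState n) :=
  {S' | (∃ i, S' = setAct S i (!S.1.1 i)) ∨
        ∃ i j, i ≠ j ∧ S' = setLink S i j (!S.1.2 i j)}

end



lemma act_setLink (S : NetState n) (i j : Fin n) (b : Bool) (p : Fin n) :
    act (setLink S i j b) p = act S p := rfl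

lemma lnk_self (S : NetState n) (i : Fin n) : lnk S i i = 0 := by
  simp [lnk, S.2.2 i]

lemma lnk_comm (S : NetState n) (i j : Fin n) : lnk S i j = lnk S j i := by
  simp [lnk, S.2.1 i j]

lemma lnk_setLink (S : NetState n) (i j : Fin n) (hij : i ≠ j) (b : Bool) (p r : Fin n) :
    lnk (setLink S i j b) p r =
      if (p = i ∧ r = j) ∨ (p = j ∧ r = i) then (if b then 1 else 0) else lnk S p r := by
  by_cases hpr : p = r
  · subst hpr
    rw [lnk_self, lnk_self, if_neg]
    rintro (⟨h1, h2⟩ | ⟨h1, h2⟩)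
    · exact hij (h1.symm.trans h2)
    · exact hij (h2.symm.trans h1)
  · by_cases hc : (p = i ∧ r = j) ∨ (p = j ∧ r = i)
    · simp [lnk, setLink, hpr, hc]
    · simp [lnk, setLink, hpr, hc]

lemma setLink_comm (S : NetState n) (i j : Fin n) (b : Bool) :
    setLink S i j b = setLink S j i b := by
  apply Subtype.ext
  simp only [setLink]
  congr 1
  funext p r
  simp only [or_comm]

lemma setLink_self (S : NetState n) (i j : Fin n) (hS : S.1.2 i j = true) :
    setLink S i j true = S := by
  apply Subtype.ext
  apply Prod.ext
  · rfl
  · funext p r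
    simp only [setLink]
    split_ifs with h1 h2
    · rw [h1, S.2.2]
    · rcases h2 with ⟨rfl, rfl⟩ | ⟨rfl, rfl⟩
      · exact hS.symm
      · rw [S.2.1, hS]
    · rfl

lemma sum_link_diff (S : NetState n) (i j : Fin n) (hij : i ≠ j) (f : Fin n → ℝ) :
    ∑ p ∈ univ.erase i, lnk (setLink S i j true) i p * f p
      - ∑ p ∈ univ.erase i, lnk (setLink S i j false) i p * f p = f j := by
  rw [← Finset.sum_sub_distrib, Finset.sum_eq_single j]
  · simp [lnk_setLink S i j hij]
  · intro p _ hp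
    simp [lnk_setLink S i j hij, hp, hij]
  · intro hj
    exact absurd (Finset.mem_erase.2 ⟨hij.symm, Finset.mem_univ j⟩) hj

lemma sum_tri_diff (q : Fin n → Fin n → Fin n → ℝ)
    (hq2 : ∀ i j k, q i j k = q i k j)
    (S : NetState n) (i j : Fin n) (hij : i ≠ j) :
    (∑ p ∈ univ.erase i, ∑ k ∈ univ.erase i,
        (if p < k then q i p k * lnk (setLink S i j true) i p * lnk (setLink S i j true) p k
          * lnk (setLink S i j true) k i else 0))
      - (∑ p ∈ univ.erase i, ∑ k ∈ univ.erase i,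
        (if p < k then q i p k * lnk (setLink S i j false) i p * lnk (setLink S i j false) p k
          * lnk (setLink S i j false) k i else 0))
      = ∑ k, q i j k * lnk S j k * lnk S k i := by
  have hj : j ∈ univ.erase i := Finset.mem_erase.2 ⟨hij.symm, Finset.mem_univ j⟩
  set F : Fin n → ℝ := fun k => q i j k * lnk S j k * lnk S k i with hF
  have key : ∀ p ∈ univ.erase i, ∀ k ∈ univ.erase i,
      (if p < k then q i p k * lnk (setLink S i j true) i p * lnk (setLink S i j true) p k
          * lnk (setLink S i j true) k i else 0)
      - (if p < k then q i p k * lnk (setLink S i j false) i p * lnk (setLink S i j false) p k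
          * lnk (setLink S i j false) k i else 0)
      = (if p = j then (if j < k then F k else 0) else 0)
        + (if k = j then (if p < j then F p else 0) else 0) := by
    intro p hp k hk
    have hp := (Finset.mem_erase.1 hp).1
    have hk := (Finset.mem_erase.1 hk).1
    by_cases hpk : p < k
    · by_cases hpj : p = j
      · subst hpj
        have hkp : k ≠ p := hpk.ne'
        simp [lnk_setLink S i p hij, hpk, hk, hp, hij, hkp, hF]
      · by_cases hkj : k = j
        · subst hkj
          simp [lnk_setLink S i k hij, hpk, hk, hp, hij, hpj, hF]
          rw [hq2 i p k, lnk_comm S i p, lnk_comm S p k]; ring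
        · simp [lnk_setLink S i j hij, hpk, hk, hp, hij, hpj, hkj]
    · by_cases hpj : p = j
      · subst hpj
        by_cases hkp : k = p
        · simp [hkp]
        · simp [hpk, hkp]
      · by_cases hkj : k = j
        · subst hkj
          simp [hpk, hpj]
        · simp [hpk, hpj, hkj]
  simp_rw [← Finset.sum_sub_distrib]
  rw [Finset.sum_congr rfl fun p hp => Finset.sum_congr rfl fun k hk => key p hp k hk]
  simp_rw [Finset.sum_add_distrib]
  rw [Finset.sum_comm]
  simp_rw [Finset.sum_ite_eq' _ j]
  simp only [hj, if_true]
  rw [← Finset.sum_add_distrib]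
  have hFi : F i = 0 := by simp [hF, lnk_self]
  rw [← Finset.sum_erase univ hFi]
  refine Finset.sum_congr rfl fun k _ => ?_
  rcases lt_trichotomy j k with hlt | heq | hgt
  · simp [hlt, hlt.not_gt]
  · subst heq
    simp [hF, lnk_self]
  · simp [hgt, hgt.not_gt]

lemma dLinkU_eq (v : Fin n → ℝ) (w : Fin n → Fin n → ℝ) (q : Fin n → Fin n → Fin n → ℝ)
    (hq2 : ∀ i j k, q i j k = q i k j) (h φ : ℝ)
    (S : NetState n) (i j : Fin n) (hij : i ≠ j) :
    dLinkU v w q h φ i j S = w i j + (∑ k, q i j k * lnk S j k * lnk S k i)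
      + φ * (act S i * act S j + (1 - act S i) * (1 - act S j)) := by
  have h1 := sum_link_diff S i j hij (w i)
  have h2 := sum_tri_diff q hq2 S i j hij
  have h3 := sum_link_diff S i j hij
    (fun p => act S i * act S p + (1 - act S i) * (1 - act S p))
  simp only [dLinkU, util, act_setLink]
  linear_combination h1 + h2 + φ * h3

/-- mutual-consent symmetry `Δ_{g_{ij}} u_i(S) = Δ_{g_{ij}} u_j(S)`;
consequently, at any state in which agent `i` has no profitable single-link deletion,
the stability constraint `g_{ij} = 1 only if Δ_{g_{ij}} u_j ≥ 0` is satisfied. -/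
theorem link_increment_symm {n : ℕ} (hn : 2 ≤ n)
    (v : Fin n → ℝ) (w : Fin n → Fin n → ℝ) (hw : ∀ i j, w i j = w j i)
    (q : Fin n → Fin n → Fin n → ℝ)
    (hq1 : ∀ i j k, q i j k = q j i k) (hq2 : ∀ i j k, q i j k = q i k j)
    (h φ : ℝ) :
    (∀ (S : NetState n) (i j : Fin n), i ≠ j →
      dLinkU v w q h φ i j S = dLinkU v w q h φ j i S) ∧
    (∀ (S : NetState n) (i : Fin n),
      (∀ j, i ≠ j → S.1.2 i j = true →
        util v w q h φ i (setLink S i j false) ≤ util v w q h φ i S) →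
      ∀ j, i ≠ j → S.1.2 i j = true → 0 ≤ dLinkU v w q h φ j i S) := by
  have hsymm : ∀ (S : NetState n) (i j : Fin n), i ≠ j →
      dLinkU v w q h φ i j S = dLinkU v w q h φ j i S := by
    intro S i j hij
    rw [dLinkU_eq v w q hq2 h φ S i j hij, dLinkU_eq v w q hq2 h φ S j i hij.symm, hw i j]
    have hs : ∑ k, q i j k * lnk S j k * lnk S k i = ∑ k, q j i k * lnk S i k * lnk S k j := by
      refine Finset.sum_congr rfl fun k _ => ?_
      rw [hq1 i j k, lnk_comm S j k, lnk_comm S k i]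
      ring
    rw [hs]
    ring
  refine ⟨hsymm, ?_⟩
  intro S i hdel j hij hS
  rw [← hsymm S i j hij, dLinkU, setLink_self S i j hS]
  exact sub_nonneg.2 (hdel j hij hS)

end NEkSN
end

section
/- Existence of equilibrium (Proposition 1, part 2): for every 1 < k ≤ n, any state S* that maximizes the potential Φ over the finite set 𝒮ₙ of all network states is a Nash equilibrium in a k-stable network; in particular, for every such k the set of NEkSN is nonempty. -/
open Finset

namespace NEkSN

variable {n : ℕ}

theorem pair_sum {n : ℕ} (i : Fin n) (D : Fin n → Fin n → ℝ) (hs : ∀ p r, D p r = D r p)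
    (h0 : ∀ p r, p ≠ i → r ≠ i → D p r = 0) :
    ∑ p, ∑ j ∈ univ.erase p, D p j = 2 * ∑ j ∈ univ.erase i, D i j := by
  rw [← Finset.add_sum_erase univ _ (mem_univ i), two_mul]
  congr 1
  refine Finset.sum_congr rfl fun p hp => ?_
  have hp' : p ≠ i := Finset.ne_of_mem_erase hp
  rw [Finset.sum_eq_single i]
  · exact hs p i
  · intro b _ hb
    exact h0 p b hp' hb
  · intro hc
    exact absurd (Finset.mem_erase.2 ⟨hp'.symm, mem_univ i⟩) hc

theorem triple_sum {n : ℕ} (i : Fin n) (D : Fin n → Fin n → Fin n → ℝ)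
    (h1 : ∀ p r s, D p r s = D r p s) (h2 : ∀ p r s, D p r s = D p s r)
    (h0 : ∀ p r s, p ≠ i → r ≠ i → s ≠ i → D p r s = 0) :
    ∑ p, ∑ j, ∑ k, (if p < j ∧ j < k then D p j k else 0)
      = ∑ j ∈ univ.erase i, ∑ k ∈ univ.erase i, (if j < k then D i j k else 0) := by
  have e1 : ∀ p j k : Fin n, (if p < j ∧ j < k then D p j k else 0)
      = (if p = i then (if p < j ∧ j < k then D p j k else 0) else 0)
        + (if j = i then (if p < j ∧ j < k then D p j k else 0) else 0)
        + (if k = i then (if p < j ∧ j < k then D p j k else 0) else 0) := by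
    intro p j k
    by_cases hc : p < j ∧ j < k
    · have a1 : p ≠ j := hc.1.ne
      have a2 : j ≠ k := hc.2.ne
      have a3 : p ≠ k := (hc.1.trans hc.2).ne
      by_cases hp : p = i
      · subst hp; simp [a1.symm, a3.symm]
      by_cases hj : j = i
      · subst hj; simp [a1, a2.symm]
      by_cases hk : k = i
      · subst hk; simp [a2, a3]
      simp [hp, hj, hk, h0 p j k hp hj hk]
    · simp [hc]
  have e2 : ∑ j ∈ univ.erase i, ∑ k ∈ univ.erase i, (if j < k then D i j k else 0)
      = ∑ j, ∑ k, (if j ≠ i ∧ k ≠ i ∧ j < k then D i j k else 0) := by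
    rw [← Finset.add_sum_erase univ (fun j => ∑ k, (if j ≠ i ∧ k ≠ i ∧ j < k then D i j k else 0))
      (mem_univ i)]
    simp only [ne_eq, not_true_eq_false, false_and, if_false, Finset.sum_const_zero, zero_add]
    refine Finset.sum_congr rfl fun j hj => ?_
    have hj' : j ≠ i := Finset.ne_of_mem_erase hj
    rw [← Finset.add_sum_erase univ (fun k => (if ¬ j = i ∧ ¬ k = i ∧ j < k then D i j k else 0))
      (mem_univ i)]
    simp only [not_true_eq_false, false_and, and_false, if_false, zero_add]
    refine Finset.sum_congr rfl fun k hk => ?_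
    have hk' : k ≠ i := Finset.ne_of_mem_erase hk
    simp [hj', hk']
  rw [e2]
  rw [Finset.sum_congr rfl fun p _ => Finset.sum_congr rfl fun j _ =>
    Finset.sum_congr rfl fun k _ => e1 p j k]
  simp only [Finset.sum_add_distrib]
  have f1 : ∑ p, ∑ j, ∑ k, (if p = i then (if p < j ∧ j < k then D p j k else 0) else 0)
      = ∑ j, ∑ k, (if i < j ∧ j < k then D i j k else 0) := by
    rw [Finset.sum_eq_single i]
    · simp
    · intro b _ hb; simp [hb]
    · simp
  have f2 : ∑ p, ∑ j, ∑ k, (if j = i then (if p < j ∧ j < k then D p j k else 0) else 0)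
      = ∑ j, ∑ k, (if j < i ∧ i < k then D i j k else 0) := by
    refine Finset.sum_congr rfl fun p _ => ?_
    rw [Finset.sum_eq_single i]
    · simp [h1 p i]
    · intro b _ hb; simp [hb]
    · simp
  have f3 : ∑ p, ∑ j, ∑ k, (if k = i then (if p < j ∧ j < k then D p j k else 0) else 0)
      = ∑ j, ∑ k, (if j < k ∧ k < i then D i j k else 0) := by
    refine Finset.sum_congr rfl fun p _ => Finset.sum_congr rfl fun j _ => ?_
    rw [Finset.sum_eq_single i]
    · simp [h2 p j i, h1 p i j]
    · intro b _ hb; simp [hb]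
    · simp
  rw [f1, f2, f3, ← Finset.sum_add_distrib, ← Finset.sum_add_distrib]
  refine Finset.sum_congr rfl fun j _ => ?_
  rw [← Finset.sum_add_distrib, ← Finset.sum_add_distrib]
  refine Finset.sum_congr rfl fun k _ => ?_
  split_ifs <;> first | (exfalso; omega) | simp

theorem lnk_symm {n : ℕ} (S : NetState n) (p r : Fin n) : lnk S p r = lnk S r p := by
  simp only [lnk, S.2.1 p r]

theorem potential_diff {n : ℕ}
    (v : Fin n → ℝ) (w : Fin n → Fin n → ℝ) (hw : ∀ i j, w i j = w j i)
    (q : Fin n → Fin n → Fin n → ℝ)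
    (hq1 : ∀ i j k, q i j k = q j i k) (hq2 : ∀ i j k, q i j k = q i k j)
    (h φ : ℝ) (i : Fin n) (S T : NetState n)
    (ha : ∀ p, p ≠ i → T.1.1 p = S.1.1 p)
    (hl : ∀ p r, p ≠ i → r ≠ i → T.1.2 p r = S.1.2 p r) :
    potential v w q h φ T - potential v w q h φ S
      = util v w q h φ i T - util v w q h φ i S := by
  have ha' : ∀ p, p ≠ i → act T p = act S p := fun p hp => by simp only [act, ha p hp]
  have hl' : ∀ p r, p ≠ i → r ≠ i → lnk T p r = lnk S p r := fun p r hp hr => by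
    simp only [lnk, hl p r hp hr]
  have k1 : ∑ p, (act T p * v p - act S p * v p) = act T i * v i - act S i * v i := by
    rw [Finset.sum_eq_single i]
    · intro b _ hb; rw [ha' b hb]; ring
    · simp
  have k2 := pair_sum i (fun p r => lnk T p r * w p r - lnk S p r * w p r)
    (fun p r => by simp only [lnk_symm T p r, lnk_symm S p r, hw p r])
    (fun p r hp hr => by simp only [hl' p r hp hr]; ring)
  have k3 := pair_sum i (fun p r => act T p * act T r - act S p * act S r)
    (fun p r => by ring)
    (fun p r hp hr => by simp only [ha' p hp, ha' r hr]; ring)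
  have k4 := pair_sum i
    (fun p r => lnk T p r * (act T p * act T r + (1 - act T p) * (1 - act T r))
      - lnk S p r * (act S p * act S r + (1 - act S p) * (1 - act S r)))
    (fun p r => by simp only [lnk_symm T p r, lnk_symm S p r]; ring)
    (fun p r hp hr => by simp only [ha' p hp, ha' r hr, hl' p r hp hr]; ring)
  have k5 := triple_sum i
    (fun p j k => q p j k * lnk T p j * lnk T j k * lnk T k p
      - q p j k * lnk S p j * lnk S j k * lnk S k p)
    (fun p r s => by
      simp only [hq1 p r s, lnk_symm T p r, lnk_symm S p r, lnk_symm T r s, lnk_symm S r s,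
        lnk_symm T s p, lnk_symm S s p]; ring)
    (fun p r s => by
      simp only [hq2 p r s, lnk_symm T p r, lnk_symm S p r, lnk_symm T r s, lnk_symm S r s,
        lnk_symm T s p, lnk_symm S s p]; ring)
    (fun p r s hp hr hs => by
      simp only [hl' p r hp hr, hl' r s hr hs, hl' s p hs hp]; ring)
  have spl : ∀ (P : Prop) [Decidable P] (x y : ℝ), (if P then x - y else 0)
      = (if P then x else 0) - (if P then y else 0) := by
    intro P _ x y; split_ifs <;> simp
  simp only [spl, Finset.sum_sub_distrib] at k1 k2 k3 k4 k5
  simp only [← Finset.mul_sum (univ.erase i)] at k3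
  simp only [potential, util, Finset.mul_sum (univ.erase i) _ (act _ i)]
  simp only [mul_assoc h, ← Finset.mul_sum (univ.erase i)] at *
  linear_combination k1 + (1 / 2) * k2 + (h / 2) * k3 + (φ / 2) * k4 + k5

theorem max_isNEkSN {n : ℕ}
    (v : Fin n → ℝ) (w : Fin n → Fin n → ℝ) (hw : ∀ i j, w i j = w j i)
    (q : Fin n → Fin n → Fin n → ℝ)
    (hq1 : ∀ i j k, q i j k = q j i k) (hq2 : ∀ i j k, q i j k = q i k j)
    (h φ : ℝ) (k : ℕ) (S : NetState n)
    (hS : ∀ T : NetState n, potential v w q h φ T ≤ potential v w q h φ S) :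
    isNEkSN v w q h φ k S := by
  rintro ⟨⟨i, I⟩, hi, hc⟩
  refine ⟨⟨by simp [nbhd], ?_⟩, ?_⟩
  · intro j hj hij
    have hne : i ≠ j := fun he => hi (he ▸ hj)
    simp only at hij
    have e : setLink S j i true = S := by
      apply Subtype.ext
      refine Prod.ext rfl ?_
      funext p r
      simp only [setLink]
      split_ifs with c1 c2
      · rw [c1, S.2.2]
      · rcases c2 with ⟨rfl, rfl⟩ | ⟨rfl, rfl⟩
        · rw [S.2.1, hij]
        · rw [hij]
      · rfl
    have d := potential_diff v w hw q hq1 hq2 h φ j (setLink S j i false) (setLink S j i true)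
      (fun p hp => rfl)
      (fun p r hp hr => by simp [setLink, hp, hr])
    simp only [dLinkU]
    rw [← d, e]
    exact sub_nonneg.2 (hS _)
  · rintro T ⟨hT, -⟩
    simp only [nbhd, Finset.mem_filter] at hT
    have d := potential_diff v w hw q hq1 hq2 h φ i S T (fun p hp => hT.2.1 p hp)
      (fun p r hp hr => hT.2.2 p r (by tauto))
    have := hS T
    simp only
    linarith

/-- Proposition 1, part 2: any maximizer of the potential over the set of
all network states is a Nash equilibrium in a `k`-stable network; in particular NEkSN is
nonempty for every `1 < k ≤ n`. -/
theorem neksn_exists {n : ℕ} (hn : 2 ≤ n)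
    (v : Fin n → ℝ) (w : Fin n → Fin n → ℝ) (hw : ∀ i j, w i j = w j i)
    (q : Fin n → Fin n → Fin n → ℝ)
    (hq1 : ∀ i j k, q i j k = q j i k) (hq2 : ∀ i j k, q i j k = q i k j)
    (h φ : ℝ) (k : ℕ) (hk1 : 1 < k) (hk2 : k ≤ n) :
    (∀ Sstar : NetState n,
      (∀ T : NetState n, potential v w q h φ T ≤ potential v w q h φ Sstar) →
      isNEkSN v w q h φ k Sstar) ∧
    ∃ S : NetState n, isNEkSN v w q h φ k S := by
  have hm := fun S => max_isNEkSN v w hw q hq1 hq2 h φ k S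
  refine ⟨hm, ?_⟩
  haveI : Nonempty (NetState n) :=
    ⟨⟨(fun _ => false, fun _ _ => false), fun _ _ => rfl, fun _ => rfl⟩⟩
  obtain ⟨S, hS⟩ := Finite.exists_max (fun S : NetState n => potential v w q h φ S)
  exact ⟨S, hm S hS⟩

end NEkSN
end
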